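/- Logical Bell-like inequality for commuting projectors (conjunction form): let P_1, …, P_n be d×d complex matrices that are Hermitian idempotents (orthogonal projections) which pairwise commute, and suppose the intersection of their ranges is the zero subspace. Then for every density matrix ρ (a Hermitian positive semidefinite d×d matrix with trace 1), ∑_{i=1}^{n} Tr(ρ P_i) ≤ n − 1. -/

import Mathlib

open Complex Matrix
open scoped ComplexOrder

/-- The trace of a positive semidefinite matrix times an orthogonal projection has
nonnegative real part. -/
theorem Matrix.PosSemidef.re_trace_mul_nonneg_of_isStarProjection {m : Type*} [Fintype m]
    {ρ Q : Matrix m m ℂ} (hρ : ρ.PosSemidef) (hQ : IsStarProjection Q) :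
    0 ≤ (ρ * Q).trace.re := by
  have htrace : (ρ * Q).trace = (Q * ρ * Qᴴ).trace := by
    have hQstar : Qᴴ = Q := hQ.isSelfAdjoint
    rw [hQstar, Matrix.trace_mul_comm (Q * ρ), ← mul_assoc, hQ.isIdempotentElem.eq,
      Matrix.trace_mul_comm]
  rw [htrace]
  exact (Complex.le_def.mp (hρ.mul_mul_conjTranspose_same Q).trace_nonneg).1

/-- For commuting orthogonal projections `A` and `B`, whose meet is `A * B`,
`Tr(ρ A) + Tr(ρ B) ≤ Tr(ρ) + Tr(ρ A B)`. -/
theorem Matrix.PosSemidef.re_trace_mul_add_le {m : Type*} [Fintype m] [DecidableEq m]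
    {ρ A B : Matrix m m ℂ} (hρ : ρ.PosSemidef) (hA : IsStarProjection A)
    (hB : IsStarProjection B) (hAB : Commute A B) :
    (ρ * A).trace.re + (ρ * B).trace.re ≤ ρ.trace.re + (ρ * (A * B)).trace.re := by
  have hcomm : Commute (1 - A) (1 - B) :=
    (Commute.one_left _).sub_left ((Commute.one_right A).sub_right hAB)
  have h := hρ.re_trace_mul_nonneg_of_isStarProjection (hA.one_sub.mul hB.one_sub hcomm)
  have hexpand : ρ * ((1 - A) * (1 - B)) = ρ - ρ * A - ρ * B + ρ * (A * B) := by
    noncomm_ring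
  rw [hexpand] at h
  simp only [Matrix.trace_add, Matrix.trace_sub, Complex.add_re, Complex.sub_re] at h
  linarith

/-- A finite family of commuting orthogonal projections has an orthogonal projection below
all of them that satisfies the Bonferroni lower bound in every density matrix. -/
theorem exists_isStarProjection_sum_re_trace_le {ι m : Type*} [Fintype m] [DecidableEq m]
    {P : ι → Matrix m m ℂ} (hP : ∀ i, IsStarProjection (P i))
    (hcomm : ∀ i j, Commute (P i) (P j)) {ρ : Matrix m m ℂ} (hρ : ρ.PosSemidef)
    (hρtr : ρ.trace = 1) (s : Finset ι) :
    ∃ Q : Matrix m m ℂ, IsStarProjection Q ∧ (∀ j, Commute (P j) Q) ∧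
      (∀ i ∈ s, P i * Q = Q) ∧
      ∑ i ∈ s, (ρ * P i).trace.re ≤ (s.card : ℝ) - 1 + (ρ * Q).trace.re := by
  classical
  induction s using Finset.induction_on with
  | empty => exact ⟨1, .one _, fun j => Commute.one_right _, by simp, by simp [hρtr]⟩
  | insert a s ha ih =>
    obtain ⟨Q, hQ, hQcomm, hPQ, hsum⟩ := ih
    refine ⟨P a * Q, (hP a).mul hQ (hQcomm a), fun j => (hcomm j a).mul_right (hQcomm j),
      ?_, ?_⟩
    · intro i hi
      rcases Finset.mem_insert.mp hi with rfl | hi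
      · rw [← mul_assoc, (hP i).isIdempotentElem.eq]
      · rw [← mul_assoc, (hcomm i a).eq, mul_assoc, hPQ i hi]
    · have h := hρ.re_trace_mul_add_le (hP a) hQ (hQcomm a)
      rw [hρtr, Complex.one_re] at h
      rw [Finset.sum_insert ha, Finset.card_insert_of_notMem ha]
      push_cast
      linarith

/-- Logical Bell-like inequality for commuting projectors (conjunction form): if
`P 1, …, P n` are pairwise commuting orthogonal projections on `ℂ^d` whose ranges have
zero intersection, then `∑ Tr(ρ P i) ≤ n - 1` for any density matrix `ρ`. -/
theorem bell_inequality_commuting_projectors_meet {d n : ℕ}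
    (P : Fin n → Matrix (Fin d) (Fin d) ℂ)
    (hproj : ∀ i, P i * P i = P i ∧ (P i)ᴴ = P i)
    (hcomm : ∀ i j, P i * P j = P j * P i)
    (hmeet : (⨅ i, LinearMap.range (Matrix.mulVecLin (P i))) = ⊥)
    (ρ : Matrix (Fin d) (Fin d) ℂ) (hρ : ρ.PosSemidef) (hρtr : ρ.trace = 1) :
    ∑ i, (Matrix.trace (ρ * P i)).re ≤ (n : ℝ) - 1 := by
  obtain ⟨Q, -, -, hPQ, hsum⟩ := exists_isStarProjection_sum_re_trace_le
    (fun i => ⟨(hproj i).1, (hproj i).2⟩) hcomm hρ hρtr Finset.univ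
  have hQ : Q = 0 := by
    refine Matrix.mulVec_injective (funext fun v => ?_)
    have hv : Q *ᵥ v ∈ ⨅ i, LinearMap.range (Matrix.mulVecLin (P i)) := by
      refine (Submodule.mem_iInf _).mpr fun i => ⟨Q *ᵥ v, ?_⟩
      rw [Matrix.mulVecLin_apply, Matrix.mulVec_mulVec, hPQ i (Finset.mem_univ i)]
    rw [hmeet, Submodule.mem_bot] at hv
    rw [hv, Matrix.zero_mulVec]
  simpa [hQ] using hsum
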